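/- If R is the inverse limit of a sequence (R_n) of unital QB-rings with surjective connecting homomorphisms, then R is a QB-ring. -/

import Mathlib

/-- The set of quasi-invertible elements of a unital ring. -/
def qInv (R : Type*) [Ring R] : Set R :=
  {u | ∃ v w : R, (∀ r : R, (1 - v * u) * r * (1 - u * w) = 0) ∧
        (∀ r : R, (1 - u * w) * r * (1 - v * u) = 0)}

/-- A unital ring `R` is a QB-ring if whenever `a x + b = 1` there is `y` with
`a + b y` quasi-invertible. -/
def IsQB (R : Type*) [Ring R] : Prop :=
  ∀ a x b : R, a * x + b = 1 → ∃ y : R, a + b * y ∈ qInv R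

/-- The inverse limit of a sequence of unital rings. -/
def invLim (R : ℕ → Type*) [∀ n, Ring (R n)]
    (π : ∀ n, R (n + 1) →+* R n) : Subring (∀ n, R n) where
  carrier := {x | ∀ n, π n (x (n + 1)) = x n}
  zero_mem' := by intro n; simp
  one_mem' := by intro n; simp
  add_mem' := by intro a b ha hb n; simp [ha n, hb n]
  mul_mem' := by intro a b ha hb n; simp [ha n, hb n]
  neg_mem' := by intro a ha n; simp [ha n]

/-- `v` is a quasi-inverse of `u`. -/
def QI {R : Type*} [Ring R] (u v : R) : Prop :=
  u * v * u = u ∧ v * u * v = v ∧ (∀ r : R, (1 - u * v) * r * (1 - v * u) = 0) ∧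
    (∀ r : R, (1 - v * u) * r * (1 - u * v) = 0)

theorem QI.symm {R : Type*} [Ring R] {u v : R} (h : QI u v) : QI v u :=
  ⟨h.2.1, h.1, h.2.2.2, h.2.2.1⟩

theorem QI.mem {R : Type*} [Ring R] {u v : R} (h : QI u v) : u ∈ qInv R :=
  ⟨v, v, h.2.2.2, h.2.2.1⟩

theorem QI.of_three {R : Type*} [Ring R] {u v : R} (h : u * v * u = u)
    (h1 : ∀ r : R, (1 - u * v) * r * (1 - v * u) = 0)
    (h2 : ∀ r : R, (1 - v * u) * r * (1 - u * v) = 0) : QI u v := by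
  refine ⟨h, ?_, h1, h2⟩
  have e := h2 v
  have e2 : (1 - v * u) * v * (1 - u * v) =
      v - v * u * v - v * u * v + v * (u * v * u) * v := by noncomm_ring
  rw [e2, h] at e
  have e3 : v - v * u * v = 0 := by rw [← e]; noncomm_ring
  exact (sub_eq_zero.mp e3).symm

/-- combination of two one-sided quasi-inverses -/
theorem QI.of_pair {R : Type*} [Ring R] {u a b : R}
    (h1 : ∀ r : R, (1 - u * a) * r * (1 - b * u) = 0)
    (h2 : ∀ r : R, (1 - b * u) * r * (1 - u * a) = 0) : QI u (a + b - a * u * b) := by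
  have p : 1 - u * (a + b - a * u * b) = (1 - u * a) * (1 - u * b) := by noncomm_ring
  have q : 1 - (a + b - a * u * b) * u = (1 - a * u) * (1 - b * u) := by noncomm_ring
  refine QI.of_three ?_ ?_ ?_
  · have e := h1 u
    have e2 : u * (a + b - a * u * b) * u = u - (1 - u * a) * u * (1 - b * u) := by
      noncomm_ring
    rw [e2, e, sub_zero]
  · intro r
    rw [p, q]
    have := h1 ((1 - u * b) * r * (1 - a * u))
    simpa only [mul_assoc] using this
  · intro r
    rw [p, q]
    have := h2 r
    calc _ = (1 - a * u) * ((1 - b * u) * r * (1 - u * a)) * (1 - u * b) := by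
            simp only [mul_assoc]
      _ = 0 := by rw [this]; simp

theorem exists_QI {R : Type*} [Ring R] {u : R} (h : u ∈ qInv R) : ∃ v, QI u v := by
  obtain ⟨v, w, h1, h2⟩ := h
  exact ⟨_, QI.of_pair h2 h1⟩

theorem QI.adjust {R : Type*} [Ring R] {W T : R} (h : QI W T) (A : R) :
    QI W (A + T - T * W * A * W * T) := by
  obtain ⟨hW, hT, h1, h2⟩ := h
  have p : 1 - W * (A + T - T * W * A * W * T) = (1 - W * A) * (1 - W * T) := by
    have : W * (A + T - T * W * A * W * T) = W * A + W * T - (W * T * W) * A * W * T := by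
      noncomm_ring
    rw [this, hW]; noncomm_ring
  have q : 1 - (A + T - T * W * A * W * T) * W = (1 - T * W) * (1 - A * W) := by
    have : (A + T - T * W * A * W * T) * W = A * W + T * W - T * W * A * (W * T * W) := by
      noncomm_ring
    rw [this, hW]; noncomm_ring
  refine QI.of_three ?_ ?_ ?_
  · have : W * (A + T - T * W * A * W * T) * W
        = W * A * W + W * T * W - (W * T * W) * A * (W * T * W) := by noncomm_ring
    rw [this, hW]; abel
  · intro r
    rw [p, q]
    calc _ = (1 - W * A) * ((1 - W * T) * r * (1 - T * W)) * (1 - A * W) := by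
            simp only [mul_assoc]
      _ = 0 := by rw [h1]; simp
  · intro r
    rw [p, q]
    calc _ = (1 - T * W) * ((1 - A * W) * r * (1 - W * A)) * (1 - W * T) := by
            simp only [mul_assoc]
      _ = 0 := by rw [h2]

theorem lift_inv {R S : Type*} [Ring R] [Ring S] (f : R →+* S) (hf : Function.Surjective f)
    {W : R} (hW : W ∈ qInv R) {v : S} (h : QI (f W) v) : ∃ T, QI W T ∧ f T = v := by
  obtain ⟨T, hT⟩ := exists_QI hW
  obtain ⟨A, rfl⟩ := hf v
  refine ⟨_, hT.adjust A, ?_⟩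
  have e := congrArg f hT.2.1
  have e1 := h.1
  simp only [map_add, map_sub, map_mul] at *
  have : f T * f W * f A * f W * f T = f T * (f W * f A * f W) * f T := by noncomm_ring
  rw [this, e1, e]; abel

theorem QI.mul_unit {R : Type*} [Ring R] {u v g h : R} (k : QI u v) (gh : g * h = 1)
    (hg : h * g = 1) : u * g ∈ qInv R := by
  have p : 1 - u * g * (h * v) = 1 - u * v := by
    have : u * g * (h * v) = u * (g * h) * v := by simp only [mul_assoc]
    rw [this, gh, mul_one]
  have q : 1 - h * v * (u * g) = h * (1 - v * u) * g := by
    rw [mul_sub, sub_mul, mul_one, hg]; simp only [mul_assoc]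
  refine ⟨h * v, h * v, ?_, ?_⟩
  · intro r
    rw [p, q]
    calc _ = h * ((1 - v * u) * (g * r) * (1 - u * v)) := by simp only [mul_assoc]
      _ = 0 := by rw [k.2.2.2]; simp
  · intro r
    rw [p, q]
    calc _ = ((1 - u * v) * (r * h) * (1 - v * u)) * g := by simp only [mul_assoc]
      _ = 0 := by rw [k.2.2.1]; simp

theorem lift_aux {R S : Type*} [Ring R] [Ring S] (f : R →+* S) (hf : Function.Surjective f)
    (hR : IsQB R) {a x b : R} (hab : a * x + b = 1) (h : QI (f a) (f x)) :
    ∃ z : R, a + b * z ∈ qInv R ∧ ∃ t, f z = f a * t := by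
  obtain ⟨y, hy⟩ := hR x a (1 - x * a) (by abel)
  obtain ⟨h1, h2, h3, h4⟩ := h
  set u := f a with hu
  set v := f x with hv
  have hw : f (x + (1 - x * a) * y) = v + (1 - v * u) * f y := by simp [hu, hv]
  have huw : u * (v + (1 - v * u) * f y) = u * v := by
    have : u * (v + (1 - v * u) * f y) = u * v + (u - u * v * u) * f y := by noncomm_ring
    rw [this, h1]; simp
  have hwu : 1 - (v + (1 - v * u) * f y) * u = (1 - v * u) * (1 - f y * u) := by noncomm_ring
  have hQ : QI (f (x + (1 - x * a) * y)) u := by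
    rw [hw]
    apply QI.symm
    refine QI.of_three ?_ ?_ ?_
    · rw [huw, h1]
    · intro r
      rw [huw, hwu, ← mul_assoc, h3, zero_mul]
    · intro r
      rw [huw, hwu, mul_assoc (1 - v * u), h4]
  obtain ⟨T, hT, hTu⟩ := lift_inv f hf hy hQ
  set W := x + (1 - x * a) * y with hWdef
  refine ⟨(1 - a * y) * T, ?_, 1 - f y * u, ?_⟩
  swap
  · simp only [map_mul, map_sub, map_one, hTu, ← hu]; noncomm_ring
  have hb : b = 1 - a * x := by rw [← hab]; abel
  have hPW : (1 - W * T) * W = 0 := by rw [sub_mul, one_mul, hT.1, sub_self]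
  have hPT : T * (1 - W * T) = 0 := by
    rw [mul_sub, mul_one, ← mul_assoc, hT.2.1, sub_self]
  have sq : (W * a * (1 - W * T)) * (W * a * (1 - W * T)) = 0 := by
    calc _ = W * a * ((1 - W * T) * W) * a * (1 - W * T) := by simp only [mul_assoc]
      _ = 0 := by rw [hPW]; simp
  have key : a + b * ((1 - a * y) * T) = T * (1 + W * a * (1 - W * T)) := by
    have e1 : T * (1 + W * a * (1 - W * T))
        = T + a * (1 - W * T) - (1 - T * W) * a * (1 - W * T) := by noncomm_ring
    rw [e1, hT.2.2.2, sub_zero]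
    rw [hb, hWdef]; noncomm_ring
  rw [key]
  refine QI.mul_unit hT.symm (h := 1 - W * a * (1 - W * T)) ?_ ?_
  · generalize W * a * (1 - W * T) = k at sq
    have : (1 + k) * (1 - k) = 1 - k * k := by noncomm_ring
    rw [this, sq, sub_zero]
  · generalize W * a * (1 - W * T) = k at sq
    have : (1 - k) * (1 + k) = 1 - k * k := by noncomm_ring
    rw [this, sq, sub_zero]

theorem lift_ker {R S : Type*} [Ring R] [Ring S] (f : R →+* S) (hf : Function.Surjective f)
    (hR : IsQB R) {a x b : R} (hab : a * x + b = 1) {v : S} (h : QI (f a) v) :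
    ∃ z : R, a + b * z ∈ qInv R ∧ f z = 0 := by
  obtain ⟨c, rfl⟩ := hf v
  have hb : b = 1 - a * x := by rw [← hab]; abel
  have e : a * (c + x * (1 - a * c)) + b * (1 - a * c) = 1 := by rw [hb]; noncomm_ring
  obtain ⟨h1, h2, h3, h4⟩ := h
  have hpu : (1 - f a * f c) * f a = 0 := by rw [sub_mul, one_mul, h1, sub_self]
  have hvu : f (c + x * (1 - a * c)) * f a = f c * f a := by
    simp only [map_add, map_mul, map_sub, map_one]
    rw [add_mul, mul_assoc, hpu, mul_zero, add_zero]
  have huv : 1 - f a * f (c + x * (1 - a * c)) = (1 - f a * f x) * (1 - f a * f c) := by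
    simp only [map_add, map_mul, map_sub, map_one]; noncomm_ring
  have hQ : QI (f a) (f (c + x * (1 - a * c))) := by
    refine QI.of_three ?_ ?_ ?_
    · rw [mul_assoc, hvu, ← mul_assoc, h1]
    · intro r
      rw [huv, hvu, mul_assoc (1 - f a * f x), mul_assoc (1 - f a * f x), h3, mul_zero]
    · intro r
      rw [huv, hvu, ← mul_assoc, mul_assoc (1 - f c * f a), h4]
  obtain ⟨z, hz, t, ht⟩ := lift_aux f hf hR e hQ
  refine ⟨(1 - a * c) * z, ?_, ?_⟩
  · rwa [← mul_assoc]
  · simp only [map_mul, map_sub, map_one, ht]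
    rw [← mul_assoc, hpu, zero_mul]

theorem lift_step {R S : Type*} [Ring R] [Ring S] (f : R →+* S) (hf : Function.Surjective f)
    (hR : IsQB R) {a x b : R} (hab : a * x + b = 1) {y v : S} (h : QI (f a + f b * y) v) :
    ∃ Y V : R, QI (a + b * Y) V ∧ f Y = y ∧ f V = v := by
  obtain ⟨Y, rfl⟩ := hf y
  have e : (a + b * Y) * x + b * (1 - Y * x) = 1 := by
    have : (a + b * Y) * x + b * (1 - Y * x) = a * x + b := by noncomm_ring
    rw [this, hab]
  have h' : QI (f (a + b * Y)) v := by simpa using h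
  obtain ⟨z, hz, hz0⟩ := lift_ker f hf hR e h'
  have e2 : a + b * Y + b * (1 - Y * x) * z = a + b * (Y + (1 - Y * x) * z) := by noncomm_ring
  rw [e2] at hz
  have e3 : f (Y + (1 - Y * x) * z) = f Y := by simp [hz0]
  obtain ⟨V, hV, hVv⟩ := lift_inv f hf hz (v := v) (by
    rw [map_add, map_mul, e3]; exact h)
  exact ⟨_, V, hV, e3, hVv⟩

/-- A surjective inverse limit of unital QB-rings is a QB-ring. -/
theorem stmt9 (R : ℕ → Type*) [∀ n, Ring (R n)]
    (π : ∀ n, R (n + 1) →+* R n)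
    (hsurj : ∀ n, Function.Surjective (π n))
    (hqb : ∀ n, IsQB (R n)) :
    IsQB ↥(invLim R π) := by
  rintro ⟨a, ha⟩ ⟨x, hx⟩ ⟨b, hb⟩ hab
  have hab' : ∀ n, a n * x n + b n = 1 := fun n =>
    congrFun (congrArg Subtype.val hab) n
  have ha' : ∀ n, π n (a (n + 1)) = a n := ha
  have hb' : ∀ n, π n (b (n + 1)) = b n := hb
  have step : ∀ n (s : {s : R n × R n // QI (a n + b n * s.1) s.2}),
      ∃ t : {s : R (n + 1) × R (n + 1) // QI (a (n + 1) + b (n + 1) * s.1) s.2},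
        π n t.1.1 = s.1.1 ∧ π n t.1.2 = s.1.2 := by
    rintro n ⟨⟨y, v⟩, h⟩
    obtain ⟨Y, V, hQ, h1, h2⟩ := lift_step (π n) (hsurj n) (hqb (n + 1)) (hab' (n + 1))
      (y := y) (v := v) (by rw [ha', hb']; exact h)
    exact ⟨⟨(Y, V), hQ⟩, h1, h2⟩
  choose F hF using step
  obtain ⟨y0, hy0⟩ := hqb 0 _ _ _ (hab' 0)
  obtain ⟨v0, hv0⟩ := exists_QI hy0
  let s : ∀ n, {s : R n × R n // QI (a n + b n * s.1) s.2} :=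
    fun n => Nat.rec ⟨(y0, v0), hv0⟩ (fun n t => F n t) n
  have hs : ∀ n, s (n + 1) = F n (s n) := fun n => rfl
  refine ⟨⟨fun n => (s n).1.1, fun n => ?_⟩, ⟨fun n => (s n).1.2, fun n => ?_⟩,
    ⟨fun n => (s n).1.2, fun n => ?_⟩, ?_, ?_⟩
  · exact (hF n (s n)).1
  · exact (hF n (s n)).2
  · exact (hF n (s n)).2
  · rintro ⟨r, hr⟩
    apply Subtype.ext
    funext n
    exact (s n).2.2.2.2 (r n)
  · rintro ⟨r, hr⟩
    apply Subtype.ext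
    funext n
    exact (s n).2.2.2.1 (r n)
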